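/- Let G be a finite simple graph, let k ≥ 2 be an integer, and let S be a minimum k-forcing set of G (i.e., S is a k-forcing set with |S| = F_k(G)). If w ∈ V - S and deg(w) ≥ k, then w has at least k - 1 neighbors in V - S. -/

import Mathlib

open Finset SimpleGraph

/-- One round of the `k`-forcing color change rule: to the currently colored set `C` we add
every vertex `w` having a colored neighbor `v` with at most `k` non-colored neighbors. -/
def kForceStep {V : Type*} [Fintype V] [DecidableEq V] (G : SimpleGraph V)
    [DecidableRel G.Adj] (k : ℕ) (C : Finset V) : Finset V :=
  C ∪ Finset.univ.filter (fun w =>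
    ∃ v ∈ C, G.Adj v w ∧ ((G.neighborFinset v) \ C).card ≤ k)

/-- `S` is a `k`-forcing set: iterating the color change rule starting from `S`
eventually colors all vertices. -/
def IsKForcingSet {V : Type*} [Fintype V] [DecidableEq V] (G : SimpleGraph V)
    [DecidableRel G.Adj] (k : ℕ) (S : Finset V) : Prop :=
  (kForceStep G k)^[Fintype.card V] S = Finset.univ

/-- The `k`-forcing number: the minimum cardinality of a `k`-forcing set. -/
noncomputable def kForcingNumber {V : Type*} [Fintype V] [DecidableEq V] (G : SimpleGraph V)
    [DecidableRel G.Adj] (k : ℕ) : ℕ :=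
  sInf {m | ∃ S : Finset V, IsKForcingSet G k S ∧ S.card = m}

theorem subset_kForceStep {V : Type*} [Fintype V] [DecidableEq V] (G : SimpleGraph V)
    [DecidableRel G.Adj] (k : ℕ) (C : Finset V) : C ⊆ kForceStep G k C :=
  subset_union_left

theorem kForceStep_mono {V : Type*} [Fintype V] [DecidableEq V] (G : SimpleGraph V)
    [DecidableRel G.Adj] (k : ℕ) : Monotone (kForceStep G k) := by
  intro C D hCD x hx
  simp only [kForceStep, mem_union, mem_filter, mem_univ, true_and] at hx ⊢
  obtain hx | ⟨v, hv, hadj, hcard⟩ := hx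
  · exact Or.inl (hCD hx)
  · exact Or.inr ⟨v, hCD hv, hadj, (card_le_card (sdiff_subset_sdiff subset_rfl hCD)).trans hcard⟩

/-- Iterating an inflationary map on finsets makes the cardinality grow until a fixed point
is reached. -/
theorem isFixedPt_iterate_or_le_card {α : Type*} {f : Finset α → Finset α}
    (hf : ∀ C, C ⊆ f C) (C : Finset α) (n : ℕ) :
    Function.IsFixedPt f (f^[n] C) ∨ n ≤ (f^[n] C).card := by
  induction n with
  | zero => exact Or.inr (Nat.zero_le _)
  | succ n ih =>
    rw [Function.iterate_succ_apply']
    by_cases h : Function.IsFixedPt f (f^[n] C)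
    · exact Or.inl (congrArg f h)
    · have hlt := card_lt_card ((hf (f^[n] C)).ssubset_of_ne (Ne.symm h))
      have hle := ih.resolve_left h
      exact Or.inr (by omega)

theorem IsKForcingSet.of_subset_kForceStep {V : Type*} [Fintype V] [DecidableEq V]
    {G : SimpleGraph V} [DecidableRel G.Adj] {k : ℕ} {S T : Finset V}
    (hS : IsKForcingSet G k S) (hST : S ⊆ kForceStep G k T) : IsKForcingSet G k T := by
  have hsucc : kForceStep G k ((kForceStep G k)^[Fintype.card V] T) = univ := by
    rw [← Function.iterate_succ_apply' (kForceStep G k), Function.iterate_succ_apply,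
      ← univ_subset_iff]
    exact hS.symm.subset.trans ((kForceStep_mono G k).iterate _ hST)
  obtain h | h := isFixedPt_iterate_or_le_card (subset_kForceStep G k) T (Fintype.card V)
  · exact h.symm.trans hsucc
  · exact (card_eq_iff_eq_univ _).1 (le_antisymm (card_le_univ _) h)

theorem kForcingNumber_le_card {V : Type*} [Fintype V] [DecidableEq V]
    {G : SimpleGraph V} [DecidableRel G.Adj] {k : ℕ} {S : Finset V}
    (hS : IsKForcingSet G k S) : kForcingNumber G k ≤ S.card :=
  Nat.sInf_le ⟨S, hS, rfl⟩

/-- Lemma 2: Let `k ≥ 2` and `S` a minimum `k`-forcing set of `G`.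
If `w ∈ V - S` and `deg w ≥ k`, then `w` has at least `k - 1` neighbors in `V - S`. -/
theorem min_kForcingSet_outside_vertex_neighbors {V : Type*} [Fintype V] [DecidableEq V]
    (G : SimpleGraph V) [DecidableRel G.Adj]
    (k : ℕ) (hk : 2 ≤ k) (S : Finset V) (hS : IsKForcingSet G k S)
    (hmin : S.card = kForcingNumber G k)
    (w : V) (hw : w ∉ S) (hdeg : k ≤ G.degree w) :
    k - 1 ≤ ((G.neighborFinset w) \ S).card := by
  by_contra! hlt
  have hsplit := card_sdiff_add_card_inter (G.neighborFinset w) S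
  rw [G.card_neighborFinset_eq_degree] at hsplit
  obtain ⟨U, hU, hUcard⟩ := exists_subset_card_eq (s := G.neighborFinset w ∩ S) (n := 2)
    (by omega)
  have hUS : U ⊆ S := hU.trans inter_subset_right
  have hcard : ((G.neighborFinset w) \ insert w (S \ U)).card ≤ k := by
    have hsub : (G.neighborFinset w) \ insert w (S \ U) ⊆ (G.neighborFinset w) \ S ∪ U := by
      intro x
      simp only [mem_sdiff, mem_insert, mem_union]
      tauto
    have := (card_le_card hsub).trans (card_union_le _ _)
    omega
  have hST : S ⊆ kForceStep G k (insert w (S \ U)) := by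
    intro x hx
    by_cases hxU : x ∈ U
    · have hadj : G.Adj w x := (G.mem_neighborFinset w x).1 (mem_inter.1 (hU hxU)).1
      exact mem_union_right _ (mem_filter.2
        ⟨mem_univ x, w, mem_insert_self w _, hadj, hcard⟩)
    · exact subset_kForceStep G k _ (mem_insert_of_mem (mem_sdiff.2 ⟨hx, hxU⟩))
  have hle := kForcingNumber_le_card (hS.of_subset_kForceStep hST)
  have hins := card_insert_le w (S \ U)
  have hsdiff := card_sdiff_add_card_eq_card hUS
  omega
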